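/- arXiv:1812.09672 — 8 statements merged into one kernel-verified Lean document; each statement's English description precedes it below -/
import Mathlib

section
/- Let ρ₁, ρ₂ : ℝ^d → ℝ be continuous density functions with ρ₂(x) > 0 for all x, let μ₁, μ₂ be the measures on ℝ^d with densities ρ₁, ρ₂ with respect to Lebesgue measure, and let ε ≥ 0. If for every measurable set A ⊆ ℝ^d both μ₁(A) ≤ e^ε · μ₂(A) and μ₂(A) ≤ e^ε · μ₁(A), then sup_x |log(ρ₁(x)/ρ₂(x))| ≤ ε. -/
open MeasureTheory

/-- Setwise domination of measures with continuous densities implies pointwise domination of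
the densities. -/
theorem le_mul_of_withDensity_le {α : Type*} [TopologicalSpace α] [MeasurableSpace α]
    [OpensMeasurableSpace α] {μ : Measure α} [SigmaFinite μ] [μ.IsOpenPosMeasure]
    {f g : α → ℝ} (hf : Continuous f) (hg : Continuous g) (hg0 : ∀ x, 0 ≤ g x)
    {c : ℝ} (hc : 0 ≤ c)
    (h : ∀ A, MeasurableSet A → (μ.withDensity fun x => ENNReal.ofReal (f x)) A ≤
      ENNReal.ofReal c * (μ.withDensity fun x => ENNReal.ofReal (g x)) A) (x : α) :
    f x ≤ c * g x := by
  have hae : (fun x => ENNReal.ofReal (f x)) ≤ᵐ[μ] fun x => ENNReal.ofReal (c * g x) := by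
    refine ae_le_of_forall_setLIntegral_le_of_sigmaFinite hf.measurable.ennreal_ofReal
      fun s hs _ => ?_
    simp_rw [ENNReal.ofReal_mul hc]
    rw [lintegral_const_mul _ hg.measurable.ennreal_ofReal]
    simpa only [withDensity_apply _ hs] using h s hs
  have hdense : Dense {x | f x ≤ c * g x} := Measure.dense_of_ae <| by
    filter_upwards [hae] with y hy
    exact (ENNReal.ofReal_le_ofReal_iff (mul_nonneg hc (hg0 y))).1 hy
  have hclosed : IsClosed {x | f x ≤ c * g x} := isClosed_le hf (continuous_const.mul hg)
  exact hclosed.closure_subset (hdense x)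

/-- The differential-privacy inequalities imply bounded max-divergence,
for continuous densities. -/
theorem stmt_2 {d : ℕ} (ρ₁ ρ₂ : EuclideanSpace ℝ (Fin d) → ℝ)
    (h₁c : Continuous ρ₁) (h₂c : Continuous ρ₂)
    (h₁0 : ∀ x, 0 ≤ ρ₁ x) (h₂0 : ∀ x, 0 < ρ₂ x)
    (ε : ℝ) (hε : 0 ≤ ε)
    (hdp : ∀ A : Set (EuclideanSpace ℝ (Fin d)), MeasurableSet A →
      (volume.withDensity fun x => ENNReal.ofReal (ρ₁ x)) A ≤
        ENNReal.ofReal (Real.exp ε) * (volume.withDensity fun x => ENNReal.ofReal (ρ₂ x)) A ∧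
      (volume.withDensity fun x => ENNReal.ofReal (ρ₂ x)) A ≤
        ENNReal.ofReal (Real.exp ε) * (volume.withDensity fun x => ENNReal.ofReal (ρ₁ x)) A) :
    ∀ x, |Real.log (ρ₁ x / ρ₂ x)| ≤ ε := by
  intro x
  have h₁ := le_mul_of_withDensity_le h₁c h₂c (fun y => (h₂0 y).le) (Real.exp_nonneg ε)
    (fun A hA => (hdp A hA).1) x
  have h₂ := le_mul_of_withDensity_le h₂c h₁c h₁0 (Real.exp_nonneg ε)
    (fun A hA => (hdp A hA).2) x
  have hpos : 0 < ρ₁ x := pos_of_mul_pos_right ((h₂0 x).trans_le h₂) (Real.exp_nonneg ε)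
  rw [abs_le]
  constructor
  · rw [Real.le_log_iff_exp_le (div_pos hpos (h₂0 x)), le_div_iff₀ (h₂0 x), Real.exp_neg,
      inv_mul_le_iff₀ (Real.exp_pos ε)]
    exact h₂
  · rw [Real.log_le_iff_le_exp (div_pos hpos (h₂0 x)), div_le_iff₀ (h₂0 x)]
    exact h₁
end

section
/- Let g, a : ℕ → ℝ be sequences with g(k) ≥ 0 and a(k) ≥ 0 for all k, and let c > L ≥ 0 be real numbers. Suppose for all k ≥ 1, g(k) ≤ g(k−1) + L·a(k−1) − c·a(k). Then for every K ≥ 1, (c − L)·∑_{k=1}^{K} a(k) ≤ g(0) + L·a(0); consequently the series ∑_k a(k) converges and a(k) → 0 as k → ∞. -/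
/-- The quantity `g K + L * a K + (c - L) * ∑ a` is nonincreasing along the recursion. -/
theorem add_mul_sum_Icc_le_of_recursion {g a : ℕ → ℝ} {c L : ℝ}
    (hrec : ∀ k : ℕ, g (k + 1) ≤ g k + L * a k - c * a (k + 1)) (K : ℕ) :
    g K + L * a K + (c - L) * ∑ k ∈ Finset.Icc 1 K, a k ≤ g 0 + L * a 0 := by
  induction K with
  | zero => simp
  | succ K ih =>
    rw [Finset.sum_Icc_succ_top (Nat.le_add_left 1 K)]
    linarith [hrec K]

/-- Telescoping summability lemma: the partial sums of `a` are bounded, `a` is summable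
and `a k → 0`. -/
theorem stmt_7 (g a : ℕ → ℝ) (hg : ∀ k, 0 ≤ g k) (ha : ∀ k, 0 ≤ a k)
    (c L : ℝ) (hL : 0 ≤ L) (hcL : L < c)
    (hrec : ∀ k : ℕ, g (k + 1) ≤ g k + L * a k - c * a (k + 1)) :
    (∀ K : ℕ, 1 ≤ K → (c - L) * ∑ k ∈ Finset.Icc 1 K, a k ≤ g 0 + L * a 0) ∧
    Summable a ∧ Filter.Tendsto a Filter.atTop (nhds 0) := by
  have hbound (K : ℕ) : (c - L) * ∑ k ∈ Finset.Icc 1 K, a k ≤ g 0 + L * a 0 := by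
    linarith [add_mul_sum_Icc_le_of_recursion hrec K, hg K, mul_nonneg hL (ha K)]
  have hsum : Summable a := by
    rw [← summable_nat_add_iff 1]
    refine summable_of_sum_range_le (c := (g 0 + L * a 0) / (c - L)) (fun k => ha _) fun K => ?_
    rw [le_div_iff₀' (sub_pos.mpr hcL), Finset.range_eq_Ico, Finset.sum_Ico_add' a 0 K 1]
    exact hbound K
  exact ⟨fun K _ => hbound K, hsum, hsum.tendsto_atTop_zero⟩
end

section
/- Let E be a real inner product space, f : E → E a map, and for each k ∈ ℕ let G_k : E → ℝ be differentiable with G_k ≥ 0 and with l-Lipschitz gradient, where l > 0. Let L > 0 satisfy l·L ≤ 1/2 and suppose |G_{k+1}(f(z)) − G_k(z)| ≤ L‖∇G_k(z)‖² for all k and z. Let η satisfy (1 − √(1 − 2lL))/l < η < 1/l, and let (z_k)_{k∈ℕ} be a sequence in E satisfying z_k = f(z_{k−1}) − η·∇G_k(z_k) for all k ≥ 1. Then the series ∑_k ‖∇G_k(z_k)‖² converges, ∇G_k(z_k) → 0 as k → ∞, and ‖z_k − f(z_{k−1})‖ → 0 as k → ∞. -/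
/-- Quadratic lower bound for a function with Lipschitz gradient. -/
theorem add_inner_sub_le_of_lipschitz_gradient {E : Type*} [NormedAddCommGroup E]
    [InnerProductSpace ℝ E] [CompleteSpace E] {G : E → ℝ} {g : E → E} {l : ℝ}
    (hgrad : ∀ x, HasGradientAt G (g x) x) (hlip : ∀ x y, ‖g y - g x‖ ≤ l * ‖y - x‖) (x v : E) :
    G x + inner ℝ (g x) v - l / 2 * ‖v‖ ^ 2 ≤ G (x + v) := by
  let φ : ℝ → ℝ := fun t => G (x + t • v) - t * inner ℝ (g x) v + l / 2 * ‖v‖ ^ 2 * t ^ 2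
  have hφ : ∀ t, HasDerivAt φ
      (inner ℝ (g (x + t • v)) v - inner ℝ (g x) v + l * ‖v‖ ^ 2 * t) t := by
    intro t
    have hline : HasDerivAt (fun t : ℝ => x + t • v) v t := by
      simpa using ((hasDerivAt_id t).smul_const v).const_add x
    have hcomp := (hgrad (x + t • v)).hasFDerivAt.comp_hasDerivAt t hline
    have hquad := (hasDerivAt_pow 2 t).const_mul (l / 2 * ‖v‖ ^ 2)
    refine ((hcomp.sub ((hasDerivAt_id t).mul_const (inner ℝ (g x) v))).add hquad).congr_deriv ?_
    simp only [InnerProductSpace.toDual_apply_apply]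
    push_cast
    ring
  have hmono : MonotoneOn φ (Set.Icc 0 1) := by
    refine monotoneOn_of_deriv_nonneg (convex_Icc 0 1)
      (fun t _ => (hφ t).continuousAt.continuousWithinAt)
      (fun t _ => (hφ t).differentiableAt.differentiableWithinAt) fun t ht => ?_
    rw [interior_Icc] at ht
    rw [(hφ t).deriv, ← inner_sub_left]
    have hinner := neg_le_of_abs_le (abs_real_inner_le_norm (g (x + t • v) - g x) v)
    have hnorm : ‖g (x + t • v) - g x‖ ≤ l * (t * ‖v‖) := by
      simpa [norm_smul, abs_of_pos ht.1] using hlip x (x + t • v)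
    nlinarith [mul_le_mul_of_nonneg_right hnorm (norm_nonneg v)]
  have h := hmono (Set.left_mem_Icc.2 zero_le_one) (Set.right_mem_Icc.2 zero_le_one) zero_le_one
  simp only [φ, zero_smul, one_smul, add_zero] at h
  linarith

/-- The admissible step sizes make the guaranteed decrease exceed the variation constant. -/
theorem lt_sub_half_mul_sq_of_step {l L η : ℝ} (hl : 0 < l) (hlL : l * L ≤ 1 / 2)
    (hη1 : (1 - Real.sqrt (1 - 2 * l * L)) / l < η) (hη2 : η < 1 / l) :
    L < η - l / 2 * η ^ 2 := by
  rw [div_lt_iff₀ hl] at hη1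
  rw [lt_div_iff₀ hl] at hη2
  have hs := Real.sq_sqrt (show 0 ≤ 1 - 2 * l * L by linarith)
  have hsq : (1 - η * l) ^ 2 < Real.sqrt (1 - 2 * l * L) ^ 2 :=
    pow_lt_pow_left₀ (by linarith) (by linarith) two_ne_zero
  rw [hs] at hsq
  refine lt_of_mul_lt_mul_left ?_ hl.le
  linarith

/-- A nonnegative sequence dominated by the decrements of a nonnegative sequence is summable. -/
theorem summable_of_mul_le_sub_succ {a V : ℕ → ℝ} {c : ℝ} (hc : 0 < c) (ha : ∀ k, 0 ≤ a k)
    (hV : ∀ k, 0 ≤ V k) (h : ∀ k, c * a k ≤ V k - V (k + 1)) : Summable a := by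
  refine summable_of_sum_range_le (c := V 0 / c) ha fun n => ?_
  rw [le_div_iff₀' hc, Finset.mul_sum]
  calc ∑ k ∈ Finset.range n, c * a k ≤ ∑ k ∈ Finset.range n, (V k - V (k + 1)) :=
        Finset.sum_le_sum fun k _ => h k
    _ = V 0 - V n := Finset.sum_range_sub' V n
    _ ≤ V 0 := sub_le_self _ (hV n)


/-- Convergence core of the asymptotic stability of the W₂ moving-horizon estimator. -/
theorem stmt_8 {E : Type*} [NormedAddCommGroup E] [InnerProductSpace ℝ E] [CompleteSpace E]
    (f : E → E) (G : ℕ → E → ℝ) (gG : ℕ → E → E) (l L η : ℝ)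
    (hl : 0 < l) (hL : 0 < L) (hlL : l * L ≤ 1 / 2)
    (hGnn : ∀ k x, 0 ≤ G k x)
    (hgrad : ∀ k x, HasGradientAt (G k) (gG k x) x)
    (hlip : ∀ k x y, ‖gG k y - gG k x‖ ≤ l * ‖y - x‖)
    (hvar : ∀ k z, |G (k + 1) (f z) - G k z| ≤ L * ‖gG k z‖ ^ 2)
    (hη1 : (1 - Real.sqrt (1 - 2 * l * L)) / l < η) (hη2 : η < 1 / l)
    (z : ℕ → E) (hz : ∀ k : ℕ, z (k + 1) = f (z k) - η • gG (k + 1) (z (k + 1))) :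
    Summable (fun k => ‖gG k (z k)‖ ^ 2) ∧
    Filter.Tendsto (fun k => gG k (z k)) Filter.atTop (nhds 0) ∧
    Filter.Tendsto (fun k => ‖z (k + 1) - f (z k)‖) Filter.atTop (nhds 0) := by
  have hc := lt_sub_half_mul_sq_of_step hl hlL hη1 hη2
  set c := η - l / 2 * η ^ 2 with hcdef
  have hstep : ∀ k, G (k + 1) (z (k + 1)) + c * ‖gG (k + 1) (z (k + 1))‖ ^ 2 ≤
      G k (z k) + L * ‖gG k (z k)‖ ^ 2 := by
    intro k
    have hlow := add_inner_sub_le_of_lipschitz_gradient (hgrad (k + 1)) (hlip (k + 1))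
      (z (k + 1)) (η • gG (k + 1) (z (k + 1)))
    have hf : z (k + 1) + η • gG (k + 1) (z (k + 1)) = f (z k) := eq_sub_iff_add_eq.1 (hz k)
    rw [hf, real_inner_smul_right, real_inner_self_eq_norm_sq, norm_smul, mul_pow,
      Real.norm_eq_abs, sq_abs] at hlow
    have hup := (abs_le.1 (hvar k (z k))).2
    rw [hcdef]
    linarith
  have hsum : Summable fun k => ‖gG k (z k)‖ ^ 2 :=
    summable_of_mul_le_sub_succ (V := fun k => G k (z k) + c * ‖gG k (z k)‖ ^ 2) (sub_pos.2 hc)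
      (fun k => sq_nonneg _)
      (fun k => add_nonneg (hGnn k _) (mul_nonneg (hL.trans hc).le (sq_nonneg _)))
      (fun k => by linarith [hstep k])
  have hnorm : Filter.Tendsto (fun k => ‖gG k (z k)‖) Filter.atTop (nhds 0) := by
    simpa [Real.sqrt_sq] using hsum.tendsto_atTop_zero.sqrt
  refine ⟨hsum, tendsto_zero_iff_norm_tendsto_zero.2 hnorm, ?_⟩
  have hdiff : ∀ k, ‖z (k + 1) - f (z k)‖ = |η| * ‖gG (k + 1) (z (k + 1))‖ := by
    intro k
    rw [← Real.norm_eq_abs, ← norm_smul, ← norm_neg, neg_sub,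
      sub_eq_iff_eq_add'.2 (eq_sub_iff_add_eq.1 (hz k)).symm]
  simp only [hdiff]
  simpa using (hnorm.comp (Filter.tendsto_add_atTop_nat 1)).const_mul |η|
end

section
/- Let E, F be real inner product spaces, f : E × F → E with ‖f(x₁,w₁) − f(x₂,w₂)‖ ≤ c₁‖x₁ − x₂‖ + c₂‖w₁ − w₂‖ for all x₁,x₂ ∈ E, w₁,w₂ ∈ F, where c₁ > 0, c₂ ≥ 0. For each k ≥ 1 let G_k, Ḡ_k : E → ℝ be differentiable with ∇G_k l-Lipschitz (l > 0) and ‖∇G_k(z) − ∇Ḡ_k(z)‖ ≤ D for all z ∈ E, where D ≥ 0. Let 0 < η with ηl < 1, let (w_k) be a sequence in F with ‖w_k‖ ≤ W, and let (z_k), (z̄_k) satisfy z_k = f(z_{k−1}, 0) − η∇G_k(z_k), z̄_k = f(z̄_{k−1}, w_{k−1}) − η∇Ḡ_k(z̄_k) for k ≥ 1, with z₀ = z̄₀. Then for every k ≥ 1, ‖z_k − z̄_k‖ ≤ ((c₂W + ηD)/c₁)·∑_{ℓ=1}^{k} (c₁/(1 − ηl))^ℓ. -/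
/-- The geometric sum over `Icc 1 k` satisfies the Horner recursion. -/
theorem sum_Icc_one_succ_pow {R : Type*} [CommSemiring R] (a : R) (k : ℕ) :
    ∑ i ∈ Finset.Icc 1 (k + 1), a ^ i = a * (∑ i ∈ Finset.Icc 1 k, a ^ i) + a := by
  induction k with
  | zero => simp
  | succ k ih =>
    rw [Finset.sum_Icc_succ_top (by omega)]
    nth_rw 1 [ih]
    rw [Finset.sum_Icc_succ_top (by omega)]
    ring

/-- A discrete Grönwall inequality for `u (k + 1) ≤ a * (u k + b)` with `u 0 ≤ 0`. -/
theorem le_mul_sum_Icc_pow {u : ℕ → ℝ} {a b : ℝ} (ha : 0 ≤ a) (h0 : u 0 ≤ 0)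
    (hu : ∀ k, u (k + 1) ≤ a * (u k + b)) (k : ℕ) :
    u k ≤ b * ∑ i ∈ Finset.Icc 1 k, a ^ i := by
  induction k with
  | zero => simpa using h0
  | succ k ih =>
    calc u (k + 1) ≤ a * (u k + b) := hu k
      _ ≤ a * (b * (∑ i ∈ Finset.Icc 1 k, a ^ i) + b) := by gcongr
      _ = b * ∑ i ∈ Finset.Icc 1 (k + 1), a ^ i := by rw [sum_Icc_one_succ_pow]; ring

/-- Comparison of two implicit gradient steps whose vector fields differ by at most `D`. -/
theorem norm_sub_implicit_step_le {E : Type*} [NormedAddCommGroup E] [NormedSpace ℝ E]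
    {g gb : E → E} {l D η : ℝ} (hη : 0 ≤ η)
    (hg : ∀ x y, ‖g y - g x‖ ≤ l * ‖y - x‖) (hgb : ∀ x, ‖g x - gb x‖ ≤ D)
    {p q x y : E} (hx : x = p - η • g x) (hy : y = q - η • gb y) :
    (1 - η * l) * ‖x - y‖ ≤ ‖p - q‖ + η * D := by
  have hxy : x - y = (p - q) - η • ((g x - g y) + (g y - gb y)) := by
    conv_lhs => rw [hx, hy]
    module
  have : ‖x - y‖ ≤ ‖p - q‖ + η * (l * ‖x - y‖ + D) :=
    calc ‖x - y‖ = ‖(p - q) - η • ((g x - g y) + (g y - gb y))‖ := congrArg norm hxy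
      _ ≤ ‖p - q‖ + ‖η • ((g x - g y) + (g y - gb y))‖ := norm_sub_le _ _
      _ = ‖p - q‖ + η * ‖(g x - g y) + (g y - gb y)‖ := by
        rw [norm_smul, Real.norm_of_nonneg hη]
      _ ≤ ‖p - q‖ + η * (l * ‖x - y‖ + D) := by
        gcongr
        exact norm_add_le_of_le (hg y x) (hgb y)
  linarith


/-- Robustness of the W₂ moving-horizon estimator: bound on the discrepancy between the
noise-free estimate sequence and the reference estimate sequence. -/
theorem stmt_9 {E F : Type*} [NormedAddCommGroup E] [InnerProductSpace ℝ E] [CompleteSpace E]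
    [NormedAddCommGroup F] [InnerProductSpace ℝ F]
    (f : E × F → E) (c₁ c₂ : ℝ) (hc₁ : 0 < c₁) (hc₂ : 0 ≤ c₂)
    (hf : ∀ x₁ x₂ : E, ∀ w₁ w₂ : F,
      ‖f (x₁, w₁) - f (x₂, w₂)‖ ≤ c₁ * ‖x₁ - x₂‖ + c₂ * ‖w₁ - w₂‖)
    (G Gb : ℕ → E → ℝ) (gG gGb : ℕ → E → E) (l D : ℝ) (hl : 0 < l) (hD : 0 ≤ D)
    (hGgrad : ∀ k x, HasGradientAt (G k) (gG k x) x)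
    (hGbgrad : ∀ k x, HasGradientAt (Gb k) (gGb k x) x)
    (hGlip : ∀ k x y, ‖gG k y - gG k x‖ ≤ l * ‖y - x‖)
    (hdiff : ∀ k z, ‖gG k z - gGb k z‖ ≤ D)
    (η : ℝ) (hη : 0 < η) (hηl : η * l < 1)
    (w : ℕ → F) (W : ℝ) (hw : ∀ k, ‖w k‖ ≤ W)
    (z zb : ℕ → E) (hz0 : z 0 = zb 0)
    (hz : ∀ k : ℕ, z (k + 1) = f (z k, 0) - η • gG (k + 1) (z (k + 1)))
    (hzb : ∀ k : ℕ, zb (k + 1) = f (zb k, w k) - η • gGb (k + 1) (zb (k + 1))) :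
    ∀ k : ℕ, 1 ≤ k →
      ‖z k - zb k‖ ≤ (c₂ * W + η * D) / c₁ * ∑ ℓ ∈ Finset.Icc 1 k, (c₁ / (1 - η * l)) ^ ℓ := by
  have hpos : 0 < 1 - η * l := sub_pos.2 hηl
  intro k _
  refine le_mul_sum_Icc_pow (u := fun k => ‖z k - zb k‖) (by positivity) (by simp [hz0]) ?_ k
  intro k
  have hstep := norm_sub_implicit_step_le hη.le (hGlip (k + 1)) (hdiff (k + 1)) (hz k) (hzb k)
  have hfk : ‖f (z k, 0) - f (zb k, w k)‖ ≤ c₁ * ‖z k - zb k‖ + c₂ * W := by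
    refine (hf _ _ _ _).trans ?_
    rw [zero_sub, norm_neg]
    gcongr
    exact hw k
  have hrw : c₁ / (1 - η * l) * (‖z k - zb k‖ + (c₂ * W + η * D) / c₁)
      = (c₁ * ‖z k - zb k‖ + (c₂ * W + η * D)) / (1 - η * l) := by
    field_simp
  rw [hrw, le_div_iff₀ hpos]
  linarith
end

section
/- Let K ⊆ ℝ^d be a convex compact set with positive Lebesgue measure, and let ρ, ρ̃ : ℝ^d → ℝ be continuous functions that are strictly positive on K with ∫_K ρ dx = ∫_K ρ̃ dx. Suppose the function g(x) = log(ρ(x)/ρ̃(x)) is differentiable with ‖∇g(x)‖ ≤ M for all x ∈ K, where M ≥ 0. Then for every x ∈ K, |log(ρ(x)/ρ̃(x))| ≤ M · diam(K), where diam(K) is the diameter of K. -/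
open MeasureTheory

/-- Two continuous functions with the same integral over a connected compact set of positive
finite measure agree at some point of that set. -/
theorem exists_eq_of_setIntegral_eq {X : Type*} [TopologicalSpace X] [T2Space X]
    [MeasurableSpace X] [OpensMeasurableSpace X] {μ : Measure X} [IsFiniteMeasureOnCompacts μ]
    {K : Set X} (hKconn : IsConnected K) (hKcp : IsCompact K) (hKm : μ K ≠ 0) {f g : X → ℝ}
    (hf : ContinuousOn f K) (hg : ContinuousOn g K) (hint : ∫ x in K, f x ∂μ = ∫ x in K, g x ∂μ) :
    ∃ c ∈ K, f c = g c := by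
  have hfi := hf.integrableOn_compact (μ := μ) hKcp
  have hgi := hg.integrableOn_compact (μ := μ) hKcp
  obtain ⟨c, hc, h⟩ := exists_eq_const_mul_setIntegral_of_nonneg (μ := μ)
    (f := fun x => f x - g x) (g := fun _ => 1) hKconn hKcp.measurableSet (hf.sub hg)
    (integrableOn_const hKcp.measure_lt_top.ne) (by simp only [mul_one]; exact hfi.sub hgi)
    fun _ _ => zero_le_one
  simp only [mul_one] at h
  rw [integral_sub hfi hgi, hint, sub_self, setIntegral_const, smul_eq_mul, mul_one] at h
  have hvol : μ.real K ≠ 0 := (ENNReal.toReal_pos hKm hKcp.measure_lt_top.ne).ne'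
  exact ⟨c, hc, sub_eq_zero.mp ((mul_eq_zero.mp h.symm).resolve_right hvol)⟩

/-- A gradient bound on the log-density ratio over a convex compact set yields a sup-norm
bound `M · diam K` on the log-density ratio. -/
theorem stmt_12 {d : ℕ} (K : Set (EuclideanSpace ℝ (Fin d)))
    (hKcv : Convex ℝ K) (hKcp : IsCompact K) (hKm : 0 < volume K)
    (ρ ρt : EuclideanSpace ℝ (Fin d) → ℝ) (hρc : Continuous ρ) (hρtc : Continuous ρt)
    (hρpos : ∀ x ∈ K, 0 < ρ x) (hρtpos : ∀ x ∈ K, 0 < ρt x)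
    (hint : ∫ x in K, ρ x = ∫ x in K, ρt x)
    (gg : EuclideanSpace ℝ (Fin d) → EuclideanSpace ℝ (Fin d))
    (hg : ∀ x, HasGradientAt (fun y => Real.log (ρ y / ρt y)) (gg x) x)
    (M : ℝ) (hM : 0 ≤ M) (hgb : ∀ x ∈ K, ‖gg x‖ ≤ M) :
    ∀ x ∈ K, |Real.log (ρ x / ρt x)| ≤ M * Metric.diam K := by
  intro x hx
  obtain ⟨c, hc, h⟩ := exists_eq_of_setIntegral_eq (hKcv.isConnected ⟨x, hx⟩) hKcp hKm.ne'
    hρc.continuousOn hρtc.continuousOn hint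
  have hmv := hKcv.norm_image_sub_le_of_norm_hasFDerivWithin_le
    (fun y _ => (hg y).hasFDerivAt.hasFDerivWithinAt)
    (fun y hy => by simpa using hgb y hy) hc hx
  rw [h, div_self (hρtpos c hc).ne', Real.log_one, sub_zero, Real.norm_eq_abs,
    ← dist_eq_norm] at hmv
  exact hmv.trans (mul_le_mul_of_nonneg_left (Metric.dist_le_diam_of_mem hKcp.isBounded hx hc) hM)
end

section
/- Let T ≥ 1, let ρ₀ : ℝ^d → ℝ be positive, and for k = 1,…,T let ρ_k, ρ̃_k : ℝ^d × ℝ^d → ℝ be positive functions (conditional densities). Let s_k ∈ (0,1), and let l, δ, c, D_0 ≥ 0. Suppose for all k and all a, b ∈ ℝ^d, |log(ρ_k(a,b)/ρ̃_k(a,b))| ≤ (s_k/(1−s_k))·l·δ·c^k·D_0, and suppose ∑_{k=1}^{T} (s_k/(1−s_k))·c^k ≤ ε/(l·δ·D_0) where l·δ·D_0 > 0. Define σ(x₀,…,x_T) = ρ₀(x₀)·∏_{k=1}^{T} ρ_k(x_k, x_{k−1}) and σ̃(x₀,…,x_T) = ρ₀(x₀)·∏_{k=1}^{T} ρ̃_k(x_k,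 x_{k−1}). Then for all (x₀,…,x_T), |log(σ(x₀,…,x_T)/σ̃(x₀,…,x_T))| ≤ ε. -/
/-- Differential privacy of the W₂ moving-horizon estimator over a time horizon:
bound on the log-ratio of the joint (Markov-factorized) densities. -/
theorem stmt_13 {d : ℕ} (T : ℕ) (hT : 1 ≤ T)
    (ρ₀ : EuclideanSpace ℝ (Fin d) → ℝ) (hρ₀ : ∀ x, 0 < ρ₀ x)
    (ρ ρt : ℕ → EuclideanSpace ℝ (Fin d) × EuclideanSpace ℝ (Fin d) → ℝ)
    (hρ : ∀ k ∈ Finset.Icc 1 T, ∀ p, 0 < ρ k p)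
    (hρt : ∀ k ∈ Finset.Icc 1 T, ∀ p, 0 < ρt k p)
    (s : ℕ → ℝ) (hs : ∀ k ∈ Finset.Icc 1 T, s k ∈ Set.Ioo (0 : ℝ) 1)
    (l δ c D₀ ε : ℝ) (hl : 0 ≤ l) (hδ : 0 ≤ δ) (hc : 0 ≤ c) (hD₀ : 0 ≤ D₀)
    (hpos : 0 < l * δ * D₀)
    (hcond : ∀ k ∈ Finset.Icc 1 T, ∀ a b : EuclideanSpace ℝ (Fin d),
      |Real.log (ρ k (a, b) / ρt k (a, b))| ≤ s k / (1 - s k) * (l * δ * c ^ k * D₀))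
    (hsum : ∑ k ∈ Finset.Icc 1 T, s k / (1 - s k) * c ^ k ≤ ε / (l * δ * D₀)) :
    ∀ x : ℕ → EuclideanSpace ℝ (Fin d),
      |Real.log ((ρ₀ (x 0) * ∏ k ∈ Finset.Icc 1 T, ρ k (x k, x (k - 1))) /
          (ρ₀ (x 0) * ∏ k ∈ Finset.Icc 1 T, ρt k (x k, x (k - 1))))| ≤ ε := by
  intro x
  have hratio : ∀ k ∈ Finset.Icc 1 T,
      ρ k (x k, x (k - 1)) / ρt k (x k, x (k - 1)) ≠ 0 :=
    fun k hk => (div_pos (hρ k hk _) (hρt k hk _)).ne'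
  rw [mul_div_mul_left _ _ (hρ₀ (x 0)).ne', ← Finset.prod_div_distrib, Real.log_prod hratio]
  calc |∑ k ∈ Finset.Icc 1 T, Real.log (ρ k (x k, x (k - 1)) / ρt k (x k, x (k - 1)))|
      ≤ ∑ k ∈ Finset.Icc 1 T, |Real.log (ρ k (x k, x (k - 1)) / ρt k (x k, x (k - 1)))| :=
        Finset.abs_sum_le_sum_abs _ _
    _ ≤ ∑ k ∈ Finset.Icc 1 T, s k / (1 - s k) * (l * δ * c ^ k * D₀) :=
        Finset.sum_le_sum fun k hk => hcond k hk _ _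
    _ = (∑ k ∈ Finset.Icc 1 T, s k / (1 - s k) * c ^ k) * (l * δ * D₀) := by
        rw [Finset.sum_mul]
        exact Finset.sum_congr rfl fun k _ => by ring
    _ ≤ ε := (le_div_iff₀ hpos).mp hsum
end

section
/- Let α be a type, f : α → α, η ∈ ℝ, T ≥ 1, and for k = 1,…,T let c_k > 0, s_k ∈ ℝ, and G_k : α → ℝ. Suppose ρ : {0,…,T} → (α → ℝ) takes positive values and satisfies, for all 1 ≤ k ≤ T and all x ∈ α, ρ_k(f(x)) = c_k · (ρ_{k−1}(x))^{s_k} · exp(−η·s_k·G_k(f(x))). Then for all x ∈ α, ρ_T(f^{[T]}(x)) = C_T · (ρ₀(x))^{∏_{k=1}^{T} s_k} · exp(−η·∑_{k=1}^{T} (∏_{i=k}^{T} s_i)·G_k(f^{[k]}(x))), where C_T = ∏_{k=1}^{T} c_k^{∏_{i=k+1}^{T} s_i} (with the empty product equal to 1) and f^{[k]} denotes the k-fold iterate of f. -/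
/-- Expanded formula for the density update of the entropy-regularized KL
moving-horizon estimator. -/
theorem stmt_15 {α : Type*} (f : α → α) (η : ℝ) (T : ℕ) (hT : 1 ≤ T)
    (c s : ℕ → ℝ) (hc : ∀ k ∈ Finset.Icc 1 T, 0 < c k)
    (G : ℕ → α → ℝ) (ρ : ℕ → α → ℝ) (hρ : ∀ k ≤ T, ∀ x, 0 < ρ k x)
    (hrec : ∀ k, 1 ≤ k → k ≤ T → ∀ x,
      ρ k (f x) = c k * ρ (k - 1) x ^ s k * Real.exp (-η * s k * G k (f x))) :
    ∀ x, ρ T (f^[T] x) =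
      (∏ k ∈ Finset.Icc 1 T, c k ^ (∏ i ∈ Finset.Icc (k + 1) T, s i)) *
        ρ 0 x ^ (∏ k ∈ Finset.Icc 1 T, s k) *
        Real.exp (-η * ∑ k ∈ Finset.Icc 1 T, (∏ i ∈ Finset.Icc k T, s i) * G k (f^[k] x)) := by
  intro x
  clear hT
  induction T with
  | zero => simp
  | succ n ih =>
    have hc' : ∀ k ∈ Finset.Icc 1 n, 0 < c k := fun k hk =>
      hc k (Finset.Icc_subset_Icc_right n.le_succ hk)
    have hρ₀ : 0 < ρ 0 x := hρ 0 (Nat.zero_le _) x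
    have hprod : ∏ k ∈ Finset.Icc 1 n, c k ^ (∏ i ∈ Finset.Icc (k + 1) (n + 1), s i) =
        (∏ k ∈ Finset.Icc 1 n, c k ^ (∏ i ∈ Finset.Icc (k + 1) n, s i)) ^ s (n + 1) := by
      rw [← Real.finsetProd_rpow _ _ fun k hk => (Real.rpow_pos_of_pos (hc' k hk) _).le]
      refine Finset.prod_congr rfl fun k hk => ?_
      rw [Finset.prod_Icc_succ_top (by have := (Finset.mem_Icc.1 hk).2; omega),
        Real.rpow_mul (hc' k hk).le]
    have hsum : ∑ k ∈ Finset.Icc 1 n, (∏ i ∈ Finset.Icc k (n + 1), s i) * G k (f^[k] x) =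
        (∑ k ∈ Finset.Icc 1 n, (∏ i ∈ Finset.Icc k n, s i) * G k (f^[k] x)) * s (n + 1) := by
      rw [Finset.sum_mul]
      refine Finset.sum_congr rfl fun k hk => ?_
      rw [Finset.prod_Icc_succ_top (by have := (Finset.mem_Icc.1 hk).2; omega)]
      ring
    have hC : 0 ≤ ∏ k ∈ Finset.Icc 1 n, c k ^ (∏ i ∈ Finset.Icc (k + 1) n, s i) :=
      Finset.prod_nonneg fun k hk => (Real.rpow_pos_of_pos (hc' k hk) _).le
    have hstep := hrec (n + 1) (by omega) le_rfl (f^[n] x)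
    rw [← Function.iterate_succ_apply' f n x, Nat.add_sub_cancel,
      ih hc' (fun k hk => hρ k (by omega)) (fun k h₁ h₂ => hrec k h₁ (by omega)),
      Real.mul_rpow (mul_nonneg hC (Real.rpow_pos_of_pos hρ₀ _).le) (Real.exp_pos _).le,
      Real.mul_rpow hC (Real.rpow_pos_of_pos hρ₀ _).le, ← Real.rpow_mul hρ₀.le,
      ← Real.exp_mul] at hstep
    have h₁ : 1 ≤ n + 1 := Nat.succ_pos n
    have hempty : Finset.Icc (n + 1 + 1) (n + 1) = ∅ := Finset.Icc_eq_empty (by omega)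
    rw [hstep, Finset.prod_Icc_succ_top h₁, Finset.prod_Icc_succ_top h₁ s,
      Finset.sum_Icc_succ_top h₁, hprod, hsum, hempty, Finset.prod_empty, Real.rpow_one,
      Finset.Icc_self, Finset.prod_singleton, mul_add, Real.exp_add]
    simp only [← mul_assoc]
    ring
end

section
/- Let K ⊆ ℝ^d be a compact set with positive Lebesgue measure, f : ℝ^d → ℝ^d, η ≥ 0, T ≥ 1, p ∈ ℝ, and for k = 1,…,T let a_k ≥ 0 and let G_k, G̃_k : ℝ^d → ℝ be continuous with |G_k(f^{[k]}(x)) − G̃_k(f^{[k]}(x))| ≤ β_k for all x ∈ K, where β_k ≥ 0. Let ρ₀ : ℝ^d → ℝ be continuous and strictly positive on K, and define F(x) = (ρ₀(x))^p · exp(−η·∑_{k=1}^{T} a_k·G_k(f^{[k]}(x))) and F̃(x) = (ρ₀(x))^p · exp(−η·∑_{k=1}^{T} a_k·G̃_k(f^{[k]}(x))). Then for every x ∈ K, |log( (F(x)/∫_K F) / (F̃(x)/∫_K F̃) )| ≤ 2η·∑_{k=1}^{T} a_k·β_k. -/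
open MeasureTheory

/-- Positive functions that agree up to the factor `exp B` on a set have normalizations that agree
up to the factor `exp (2 * B)`. If one of the two integrals vanishes, the quotient is zero. -/
theorem abs_log_div_setIntegral_div_le {α : Type*} [MeasurableSpace α] {μ : Measure α}
    {K : Set α} (hK : MeasurableSet K) {F H : α → ℝ} {B : ℝ} (hB : 0 ≤ B)
    (hF : ∀ x ∈ K, 0 < F x) (hH : ∀ x ∈ K, 0 < H x)
    (hFH : ∀ x ∈ K, F x ≤ Real.exp B * H x) (hHF : ∀ x ∈ K, H x ≤ Real.exp B * F x)
    {x : α} (hx : x ∈ K) :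
    |Real.log ((F x / ∫ y in K, F y ∂μ) / (H x / ∫ y in K, H y ∂μ))| ≤ 2 * B := by
  have log_le {u v : ℝ} (hu : 0 < u) (hv : 0 < v) (h : u ≤ Real.exp B * v) :
      Real.log u ≤ B + Real.log v := by
    have := Real.log_le_log hu h
    rwa [Real.log_mul (Real.exp_ne_zero B) hv.ne', Real.log_exp] at this
  by_cases hI : ∫ y in K, F y ∂μ = 0
  · simpa [hI] using hB
  by_cases hJ : ∫ y in K, H y ∂μ = 0
  · simpa [hJ] using hB
  have hFi : IntegrableOn F K μ := not_imp_comm.1 integral_undef hI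
  have hHi : IntegrableOn H K μ := not_imp_comm.1 integral_undef hJ
  have hIpos : 0 < ∫ y in K, F y ∂μ :=
    lt_of_le_of_ne (setIntegral_nonneg hK fun y hy => (hF y hy).le) (Ne.symm hI)
  have hJpos : 0 < ∫ y in K, H y ∂μ :=
    lt_of_le_of_ne (setIntegral_nonneg hK fun y hy => (hH y hy).le) (Ne.symm hJ)
  have hIJ : ∫ y in K, F y ∂μ ≤ Real.exp B * ∫ y in K, H y ∂μ := by
    rw [← integral_const_mul]
    exact setIntegral_mono_on hFi (hHi.const_mul _) hK hFH
  have hJI : ∫ y in K, H y ∂μ ≤ Real.exp B * ∫ y in K, F y ∂μ := by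
    rw [← integral_const_mul]
    exact setIntegral_mono_on hHi (hFi.const_mul _) hK hHF
  have h₁ := log_le (hF x hx) (hH x hx) (hFH x hx)
  have h₂ := log_le (hH x hx) (hF x hx) (hHF x hx)
  have h₃ := log_le hIpos hJpos hIJ
  have h₄ := log_le hJpos hIpos hJI
  rw [Real.log_div (div_pos (hF x hx) hIpos).ne' (div_pos (hH x hx) hJpos).ne',
    Real.log_div (hF x hx).ne' hI, Real.log_div (hH x hx).ne' hJ, abs_le]
  constructor <;> linarith

/-- Weighted sums of termwise close quantities are close. -/
theorem abs_sum_mul_sub_sum_mul_le {ι : Type*} (s : Finset ι) (a b u v : ι → ℝ)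
    (ha : ∀ k ∈ s, 0 ≤ a k) (h : ∀ k ∈ s, |u k - v k| ≤ b k) :
    |∑ k ∈ s, a k * u k - ∑ k ∈ s, a k * v k| ≤ ∑ k ∈ s, a k * b k := by
  rw [← Finset.sum_sub_distrib]
  refine (Finset.abs_sum_le_sum_abs _ _).trans (Finset.sum_le_sum fun k hk => ?_)
  rw [← mul_sub, abs_mul, abs_of_nonneg (ha k hk)]
  exact mul_le_mul_of_nonneg_left (h k hk) (ha k hk)

/-- Exponential weights whose exponents differ by at most `η * S` agree up to `exp (η * S)`. -/
theorem mul_exp_neg_mul_le {c η S u v : ℝ} (hc : 0 ≤ c) (hη : 0 ≤ η) (h : v - u ≤ S) :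
    c * Real.exp (-η * u) ≤ Real.exp (η * S) * (c * Real.exp (-η * v)) := by
  rw [mul_left_comm, ← Real.exp_add]
  refine mul_le_mul_of_nonneg_left (Real.exp_le_exp.2 ?_) hc
  linarith [mul_le_mul_of_nonneg_left h hη]

/-- Sensitivity of the entropy-regularized KL moving-horizon estimator: bound on the
max-divergence of the normalized densities produced from two adjacent measurement
sequences. -/
theorem stmt_16 {d : ℕ} (K : Set (EuclideanSpace ℝ (Fin d))) (hK : IsCompact K)
    (hKm : 0 < volume K)
    (f : EuclideanSpace ℝ (Fin d) → EuclideanSpace ℝ (Fin d))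
    (η : ℝ) (hη : 0 ≤ η) (T : ℕ) (hT : 1 ≤ T) (p : ℝ)
    (a β : ℕ → ℝ) (ha : ∀ k ∈ Finset.Icc 1 T, 0 ≤ a k) (hβ : ∀ k ∈ Finset.Icc 1 T, 0 ≤ β k)
    (G Gt : ℕ → EuclideanSpace ℝ (Fin d) → ℝ)
    (hGc : ∀ k ∈ Finset.Icc 1 T, Continuous (G k))
    (hGtc : ∀ k ∈ Finset.Icc 1 T, Continuous (Gt k))
    (hGd : ∀ k ∈ Finset.Icc 1 T, ∀ x ∈ K, |G k (f^[k] x) - Gt k (f^[k] x)| ≤ β k)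
    (ρ₀ : EuclideanSpace ℝ (Fin d) → ℝ) (hρ₀c : Continuous ρ₀) (hρ₀ : ∀ x ∈ K, 0 < ρ₀ x)
    (F Ft : EuclideanSpace ℝ (Fin d) → ℝ)
    (hF : F = fun x => ρ₀ x ^ p * Real.exp (-η * ∑ k ∈ Finset.Icc 1 T, a k * G k (f^[k] x)))
    (hFt : Ft = fun x => ρ₀ x ^ p * Real.exp (-η * ∑ k ∈ Finset.Icc 1 T, a k * Gt k (f^[k] x))) :
    ∀ x ∈ K,
      |Real.log ((F x / ∫ y in K, F y) / (Ft x / ∫ y in K, Ft y))| ≤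
        2 * η * ∑ k ∈ Finset.Icc 1 T, a k * β k := by
  intro x hx
  subst hF hFt
  have hsum (y) (hy : y ∈ K) := abs_le.1 <| abs_sum_mul_sub_sum_mul_le (Finset.Icc 1 T) a β
    (fun k => G k (f^[k] y)) (fun k => Gt k (f^[k] y)) ha fun k hk => hGd k hk y hy
  have hpow (y) (hy : y ∈ K) : 0 < ρ₀ y ^ p := Real.rpow_pos_of_pos (hρ₀ y hy) p
  rw [mul_assoc]
  refine abs_log_div_setIntegral_div_le hK.measurableSet
    (mul_nonneg hη (Finset.sum_nonneg fun k hk => mul_nonneg (ha k hk) (hβ k hk)))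
    (fun y hy => mul_pos (hpow y hy) (Real.exp_pos _))
    (fun y hy => mul_pos (hpow y hy) (Real.exp_pos _))
    (fun y hy => mul_exp_neg_mul_le (hpow y hy).le hη ?_)
    (fun y hy => mul_exp_neg_mul_le (hpow y hy).le hη (hsum y hy).2) hx
  linarith [(hsum y hy).1]
end
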